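/- arXiv:2405.20303 — 3 statements merged into one kernel-verified Lean document; each statement's English description precedes it below -/
import Mathlib

section
/- Let m ≥ 2 and let n ≥ 1 be odd. Let P be the profile in which ⌈n/2⌉ voters report the uniform vector u = (1/m, …, 1/m) and the other ⌊n/2⌋ voters report e₁ = (1, 0, …, 0). Then every mechanism A : (Δ^{m−1})^n → Δ^{m−1} that is truthful, anonymous, neutral, and continuous satisfies A(P) = u; consequently ‖A(P) − μ(P)‖₁ = ((m−1)/m)·((n−1)/n) and ‖A(P) − μ(P)‖_∞ = ((m−1)/(2m))·((n−1)/n). -/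
open scoped Classical BigOperators

/-- The standard simplex Δ^{m-1} as a subset of ℝ^m. -/
def simplex (m : ℕ) : Set (Fin m → ℝ) :=
  {x | (∀ j, 0 ≤ x j) ∧ ∑ j, x j = 1}

/-- ℓ1-distance on ℝ^m. -/
noncomputable def dist1 {m : ℕ} (x y : Fin m → ℝ) : ℝ :=
  ∑ j, |x j - y j|

/-- ℓ∞-distance on ℝ^m. -/
noncomputable def distInf {m : ℕ} (x y : Fin m → ℝ) : ℝ :=
  ⨆ j, |x j - y j|

/-- A mechanism is truthful if no voter can decrease the ℓ1-distance of the result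
to her true report by misreporting. -/
def Truthful {n m : ℕ} (A : (Fin n → Fin m → ℝ) → (Fin m → ℝ)) : Prop :=
  ∀ P : Fin n → Fin m → ℝ, (∀ i, P i ∈ simplex m) →
    ∀ i : Fin n, ∀ q ∈ simplex m,
      dist1 (P i) (A P) ≤ dist1 (P i) (A (Function.update P i q))

/-- Anonymity: the outcome is invariant under permutations of the voters. -/
def Anonymous {n m : ℕ} (A : (Fin n → Fin m → ℝ) → (Fin m → ℝ)) : Prop :=
  ∀ P : Fin n → Fin m → ℝ, (∀ i, P i ∈ simplex m) →
    ∀ σ : Equiv.Perm (Fin n), A (fun i => P (σ i)) = A P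

/-- Neutrality: the outcome is equivariant under permutations of the alternatives. -/
def Neutral {n m : ℕ} (A : (Fin n → Fin m → ℝ) → (Fin m → ℝ)) : Prop :=
  ∀ P : Fin n → Fin m → ℝ, (∀ i, P i ∈ simplex m) →
    ∀ σ : Equiv.Perm (Fin m), A (fun i j => P i (σ j)) = fun j => A P (σ j)

/-- The mean of a profile. -/
noncomputable def mean {n m : ℕ} (P : Fin n → Fin m → ℝ) : Fin m → ℝ :=
  fun j => (∑ i, P i j) / n

/-- The simplex vector with entry `t` at alternative `j₀` and equal entries elsewhere. -/
noncomputable def axisPoint {m : ℕ} (j₀ : Fin m) (t : ℝ) : Fin m → ℝ :=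
  fun j => if j = j₀ then t else (1 - t) / (m - 1)

lemma sum_ite_eq_add {m : ℕ} (j₀ : Fin m) (a b : ℝ) :
    ∑ j, (if j = j₀ then a else b) = a + (m - 1) * b := by
  have h : ∀ j, (if j = j₀ then a else b) = (if j = j₀ then a - b else 0) + b := by
    intro j; split_ifs <;> ring
  simp only [h, Finset.sum_add_distrib, Finset.sum_ite_eq', Finset.mem_univ, if_true,
    Finset.sum_const, Finset.card_univ, Fintype.card_fin, nsmul_eq_mul]
  ring

lemma sum_ite_val_lt (a b : ℝ) (r s : ℕ) :
    ∑ i : Fin (r + s), (if (i : ℕ) < r then a else b) = r * a + s * b := by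
  simp [Fin.sum_univ_add]

lemma axisPoint_mem_simplex {m : ℕ} (hm : 2 ≤ m) (j₀ : Fin m) {t : ℝ} (h0 : 0 ≤ t)
    (h1 : t ≤ 1) : axisPoint j₀ t ∈ simplex m := by
  have hm' : (2 : ℝ) ≤ m := by exact_mod_cast hm
  refine ⟨fun j => ?_, ?_⟩
  · unfold axisPoint
    split_ifs
    · exact h0
    · exact div_nonneg (by linarith) (by linarith)
  · unfold axisPoint
    rw [sum_ite_eq_add, mul_div_cancel₀ _ (by linarith : (m : ℝ) - 1 ≠ 0)]
    ring

lemma dist1_axisPoint {m : ℕ} (hm : 2 ≤ m) (j₀ : Fin m) (s t : ℝ) :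
    dist1 (axisPoint j₀ s) (axisPoint j₀ t) = 2 * |s - t| := by
  have hm' : (2 : ℝ) ≤ m := by exact_mod_cast hm
  have h : ∀ j, |axisPoint j₀ s j - axisPoint j₀ t j| =
      if j = j₀ then |s - t| else |s - t| / (m - 1) := by
    intro j
    unfold axisPoint
    split_ifs
    · rfl
    · rw [← sub_div, abs_div, abs_of_pos (by linarith : (0 : ℝ) < m - 1),
        show 1 - s - (1 - t) = t - s by ring, abs_sub_comm]
  unfold dist1
  simp only [h]
  rw [sum_ite_eq_add, mul_div_cancel₀ _ (by linarith : (m : ℝ) - 1 ≠ 0)]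
  ring

lemma axisPoint_inv {m : ℕ} (hm : 2 ≤ m) (j₀ : Fin m) :
    axisPoint j₀ (1 / m) = fun _ => (1 : ℝ) / m := by
  have hm' : (2 : ℝ) ≤ m := by exact_mod_cast hm
  have : (m : ℝ) - 1 ≠ 0 := by linarith
  funext j
  unfold axisPoint
  split_ifs
  · rfl
  · field_simp

lemma continuous_axisPoint {m : ℕ} (j₀ : Fin m) : Continuous (axisPoint j₀) := by
  refine continuous_pi fun j => ?_
  unfold axisPoint
  split_ifs <;> fun_prop

lemma dist1_axisPoint_zero {m : ℕ} (hm : 2 ≤ m) (j₀ : Fin m) {x : Fin m → ℝ}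
    (hx : x ∈ simplex m) (hle : ∀ j, j ≠ j₀ → x j ≤ 1 / (m - 1)) :
    dist1 (axisPoint j₀ 0) x = 2 * x j₀ := by
  have hm' : (2 : ℝ) ≤ m := by exact_mod_cast hm
  have h : ∀ j, |axisPoint j₀ 0 j - x j| =
      (axisPoint j₀ 0 j - x j) + if j = j₀ then 2 * x j₀ else 0 := by
    intro j
    unfold axisPoint
    split_ifs with hj
    · subst hj
      rw [abs_of_nonpos (by linarith [hx.1 j])]
      ring
    · rw [abs_of_nonneg (by linarith [hle j hj])]
      ring
  unfold dist1
  simp only [h, Finset.sum_add_distrib, Finset.sum_sub_distrib, hx.2,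
    (axisPoint_mem_simplex hm j₀ le_rfl zero_le_one).2, Finset.sum_ite_eq', Finset.mem_univ,
    if_true]
  ring

/-- If a group of voters switches to a common report `g`, the outcome moves no farther from `g`. -/
lemma Truthful.dist1_le_of_replace {n m : ℕ} {A : (Fin n → Fin m → ℝ) → (Fin m → ℝ)}
    (hA : Truthful A) {P : Fin n → Fin m → ℝ} (hP : ∀ i, P i ∈ simplex m)
    {g : Fin m → ℝ} (hg : g ∈ simplex m) (S : Finset (Fin n)) :
    dist1 g (A fun i => if i ∈ S then g else P i) ≤ dist1 g (A P) := by
  induction S using Finset.induction_on with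
  | empty => simp
  | insert a S ha ih =>
    refine le_trans ?_ ih
    have h := hA (fun i => if i ∈ insert a S then g else P i)
      (fun i => by split_ifs; exacts [hg, hP i]) a (P a) (hP a)
    have hupd : Function.update (fun i => if i ∈ insert a S then g else P i) a (P a) =
        fun i => if i ∈ S then g else P i := by
      funext i
      by_cases hi : i = a
      · subst hi; simp [ha]
      · simp [hi]
    rw [hupd] at h
    simpa using h

lemma Neutral.apply_eq_apply {n m : ℕ} {A : (Fin n → Fin m → ℝ) → (Fin m → ℝ)}
    (hA : Neutral A) {P : Fin n → Fin m → ℝ} (hP : ∀ i, P i ∈ simplex m) {j k : Fin m}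
    (h : ∀ i l, P i (Equiv.swap j k l) = P i l) : A P j = A P k := by
  have h1 := hA P hP (Equiv.swap j k)
  simp only [h] at h1
  simpa using congrFun h1 j

lemma eq_axisPoint {m : ℕ} (hm : 2 ≤ m) {j₀ : Fin m} {x : Fin m → ℝ} (hx : x ∈ simplex m)
    (h : ∀ j k, j ≠ j₀ → k ≠ j₀ → x j = x k) : x = axisPoint j₀ (x j₀) := by
  have hm' : (2 : ℝ) ≤ m := by exact_mod_cast hm
  funext j
  by_cases hj : j = j₀
  · subst hj; simp [axisPoint]
  · have hsum : ∑ k, x k = x j₀ + (m - 1) * x j := by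
      rw [← sum_ite_eq_add j₀]
      refine Finset.sum_congr rfl fun k _ => ?_
      split_ifs with hk
      · rw [hk]
      · exact h k j hk hj
    rw [hx.2] at hsum
    rw [axisPoint, if_neg hj, eq_div_iff (by linarith)]
    linarith

/-- The profile in which the first `r` voters report `x` and the others report `y`. -/
def twoBlock {α : Type*} {n : ℕ} (r : ℕ) (x y : α) : Fin n → α :=
  fun i => if (i : ℕ) < r then x else y

lemma twoBlock_cases {α : Type*} {n : ℕ} {p : α → Prop} (r : ℕ) {x y : α} (hx : p x)
    (hy : p y) (i : Fin n) : p (twoBlock r x y i) := by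
  unfold twoBlock
  split_ifs <;> assumption

section Mechanism

variable {m n : ℕ} {A : (Fin n → Fin m → ℝ) → (Fin m → ℝ)}

lemma apply_axisPoint_profile (hm : 2 ≤ m)
    (hmap : ∀ P : Fin n → Fin m → ℝ, (∀ i, P i ∈ simplex m) → A P ∈ simplex m)
    (hneut : Neutral A) (j₀ : Fin m) {τ : Fin n → ℝ} (hτ : ∀ i, τ i ∈ Set.Icc (0 : ℝ) 1) :
    A (fun i => axisPoint j₀ (τ i)) = axisPoint j₀ (A (fun i => axisPoint j₀ (τ i)) j₀) := by
  have hP : ∀ i, axisPoint j₀ (τ i) ∈ simplex m := fun i =>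
    axisPoint_mem_simplex hm j₀ (hτ i).1 (hτ i).2
  refine eq_axisPoint hm (hmap _ hP) fun j k hj hk => hneut.apply_eq_apply hP fun i l => ?_
  have : Equiv.swap j k l = j₀ ↔ l = j₀ := by
    rw [Equiv.swap_apply_eq_iff, Equiv.swap_apply_of_ne_of_ne hj.symm hk.symm]
  simp only [axisPoint, this]

lemma apply_uniform (hm : 2 ≤ m)
    (hmap : ∀ P : Fin n → Fin m → ℝ, (∀ i, P i ∈ simplex m) → A P ∈ simplex m)
    (hneut : Neutral A) (j₀ : Fin m) :
    A (fun _ => axisPoint j₀ (1 / m)) = axisPoint j₀ (1 / m) := by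
  have hm' : (2 : ℝ) ≤ m := by exact_mod_cast hm
  have hP : ∀ _ : Fin n, axisPoint j₀ (1 / (m : ℝ)) ∈ simplex m := fun _ =>
    axisPoint_mem_simplex hm j₀ (by positivity)
      (by rw [div_le_one (by linarith)]; linarith)
  have hc : ∀ j k, A (fun _ => axisPoint j₀ (1 / m)) j = A (fun _ => axisPoint j₀ (1 / m)) k :=
    fun j k => hneut.apply_eq_apply hP fun i l => by rw [axisPoint_inv hm]
  have hs := (hmap _ hP).2
  simp only [hc _ j₀, Finset.sum_const, Finset.card_univ, Fintype.card_fin, nsmul_eq_mul] at hs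
  rw [eq_axisPoint hm (hmap _ hP) fun j k _ _ => hc j k]
  congr 1
  rw [eq_div_iff (by linarith)]
  linarith

lemma abs_sub_le_of_replace (hm : 2 ≤ m)
    (hmap : ∀ P : Fin n → Fin m → ℝ, (∀ i, P i ∈ simplex m) → A P ∈ simplex m)
    (htruth : Truthful A) (hneut : Neutral A) (j₀ : Fin m) {τ τ' : Fin n → ℝ}
    (hτ : ∀ i, τ i ∈ Set.Icc (0 : ℝ) 1) {g : ℝ} (hg : g ∈ Set.Icc (0 : ℝ) 1)
    (h : ∀ i, τ' i = g ∨ τ' i = τ i) :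
    |g - A (fun i => axisPoint j₀ (τ' i)) j₀| ≤ |g - A (fun i => axisPoint j₀ (τ i)) j₀| := by
  have hτ' : ∀ i, τ' i ∈ Set.Icc (0 : ℝ) 1 := fun i => by
    rcases h i with h | h <;> rw [h]
    exacts [hg, hτ i]
  have key := htruth.dist1_le_of_replace
    (fun i => axisPoint_mem_simplex hm j₀ (hτ i).1 (hτ i).2)
    (axisPoint_mem_simplex hm j₀ hg.1 hg.2) (Finset.univ.filter fun i => τ' i = g)
  have he : (fun i => if i ∈ Finset.univ.filter (fun i => τ' i = g) then axisPoint j₀ g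
      else axisPoint j₀ (τ i)) = fun i => axisPoint j₀ (τ' i) := by
    funext i
    by_cases hi : τ' i = g
    · simp [hi]
    · simp only [Finset.mem_filter, Finset.mem_univ, true_and, if_neg hi]
      rw [(h i).resolve_left hi]
  rw [he, apply_axisPoint_profile hm hmap hneut j₀ hτ',
    apply_axisPoint_profile hm hmap hneut j₀ hτ, dist1_axisPoint hm, dist1_axisPoint hm] at key
  linarith

lemma continuousOn_apply_axisPoint (hm : 2 ≤ m)
    (hcont : ContinuousOn A {P : Fin n → Fin m → ℝ | ∀ i, P i ∈ simplex m}) (j₀ : Fin m)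
    {f : ℝ → Fin n → ℝ} (hf : Continuous f) {s : Set ℝ}
    (hs : ∀ t ∈ s, ∀ i, f t i ∈ Set.Icc (0 : ℝ) 1) :
    ContinuousOn (fun t => A (fun i => axisPoint j₀ (f t i)) j₀) s := by
  have h : ContinuousOn (fun t => A (fun i => axisPoint j₀ (f t i))) s :=
    hcont.comp (Continuous.continuousOn <| continuous_pi fun i =>
      (continuous_axisPoint j₀).comp ((continuous_apply i).comp hf))
      fun t ht i => axisPoint_mem_simplex hm j₀ (hs t ht i).1 (hs t ht i).2
  exact (continuous_apply j₀).comp_continuousOn h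

end Mechanism

lemma continuous_twoBlock {n r : ℕ} {f g : ℝ → ℝ} (hf : Continuous f) (hg : Continuous g) :
    Continuous fun t => (twoBlock r (f t) (g t) : Fin n → ℝ) := by
  refine continuous_pi fun i => ?_
  unfold twoBlock
  split_ifs <;> assumption

/-- A slim majority at the uniform vector against a minority at a vertex forces the uniform
outcome. -/
lemma apply_majority_uniform {m r : ℕ} (hm : 2 ≤ m)
    {A : (Fin (2 * r + 1) → Fin m → ℝ) → (Fin m → ℝ)}
    (hmap : ∀ P : Fin (2 * r + 1) → Fin m → ℝ, (∀ i, P i ∈ simplex m) → A P ∈ simplex m)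
    (htruth : Truthful A) (hanon : Anonymous A) (hneut : Neutral A)
    (hcont : ContinuousOn A {P : Fin (2 * r + 1) → Fin m → ℝ | ∀ i, P i ∈ simplex m})
    (j₀ : Fin m) :
    A (fun i => axisPoint j₀ (twoBlock (r + 1) (1 / (m : ℝ)) 1 i)) = axisPoint j₀ (1 / m) := by
  have hm' : (2 : ℝ) ≤ m := by exact_mod_cast hm
  have h0 : (0 : ℝ) ∈ Set.Icc (0 : ℝ) 1 := by simp
  have h1 : (1 : ℝ) ∈ Set.Icc (0 : ℝ) 1 := by simp
  have hu : 1 / (m : ℝ) ∈ Set.Icc (0 : ℝ) 1 :=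
    ⟨by positivity, by rw [div_le_one (by linarith)]; linarith⟩
  have hI : ∀ {x y : ℝ}, x ∈ Set.Icc (0 : ℝ) 1 → y ∈ Set.Icc (0 : ℝ) 1 →
      ∀ i : Fin (2 * r + 1), twoBlock (r + 1) x y i ∈ Set.Icc (0 : ℝ) 1 :=
    fun hx hy => twoBlock_cases (r + 1) hx hy
  set α : (Fin (2 * r + 1) → ℝ) → ℝ := fun τ => A (fun i => axisPoint j₀ (τ i)) j₀ with hα
  have hαmem : ∀ τ : Fin (2 * r + 1) → ℝ, (∀ i, τ i ∈ Set.Icc (0 : ℝ) 1) →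
      A (fun i => axisPoint j₀ (τ i)) ∈ simplex m :=
    fun τ hτ => hmap _ fun i => axisPoint_mem_simplex hm j₀ (hτ i).1 (hτ i).2
  have hα1 : ∀ τ, (∀ i, τ i ∈ Set.Icc (0 : ℝ) 1) → α τ ≤ 1 := fun τ hτ => by
    rw [← (hαmem τ hτ).2]
    exact Finset.single_le_sum (fun j _ => (hαmem τ hτ).1 j) (Finset.mem_univ j₀)
  have hα0 : ∀ τ, (∀ i, τ i ∈ Set.Icc (0 : ℝ) 1) → 0 ≤ α τ := fun τ hτ => (hαmem τ hτ).1 j₀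
  have hrep : ∀ {τ τ' : Fin (2 * r + 1) → ℝ} {g : ℝ}, (∀ i, τ i ∈ Set.Icc (0 : ℝ) 1) →
      g ∈ Set.Icc (0 : ℝ) 1 → (∀ i, τ' i = g ∨ τ' i = τ i) → |g - α τ'| ≤ |g - α τ| :=
    fun hτ hg h => abs_sub_le_of_replace hm hmap htruth hneut j₀ hτ hg h
  have hαu : α (fun _ => 1 / (m : ℝ)) = 1 / m := by
    simp only [hα]
    rw [apply_uniform hm hmap hneut]
    simp [axisPoint]
  have hαu' : α (twoBlock (r + 1) (1 / (m : ℝ)) (1 / m)) = 1 / m := by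
    have h : twoBlock (r + 1) (1 / (m : ℝ)) (1 / m) = fun _ : Fin (2 * r + 1) => 1 / (m : ℝ) :=
      funext fun i => by simp [twoBlock]
    rw [h, hαu]
  have hstep : ∀ {x y : ℝ}, x ∈ Set.Icc (0 : ℝ) 1 → y ∈ Set.Icc (0 : ℝ) 1 →
      α (twoBlock (r + 1) x y) = 1 / m → α (twoBlock (r + 1) (1 / (m : ℝ)) y) = 1 / m := by
    intro x y hx hy h
    have := hrep (τ' := twoBlock (r + 1) (1 / (m : ℝ)) y) (hI hx hy) hu fun i => by
      unfold twoBlock; split_ifs <;> simp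
    rw [h, sub_self, abs_zero] at this
    linarith [abs_nonpos_iff.1 this]
  rw [apply_axisPoint_profile hm hmap hneut j₀ (hI hu h1)]
  congr 1
  change α (twoBlock (r + 1) (1 / (m : ℝ)) 1) = 1 / m
  have hge : 1 / (m : ℝ) ≤ α (twoBlock (r + 1) (1 / (m : ℝ)) 1) := by
    have := hrep (τ := fun _ => 1 / (m : ℝ)) (τ' := twoBlock (r + 1) (1 / (m : ℝ)) 1)
      (fun _ => hu) h1 fun i => by unfold twoBlock; split_ifs <;> simp
    rw [hαu, abs_of_nonneg (by linarith [hα1 _ (hI hu h1)]),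
      abs_of_nonneg (by linarith [hu.2])] at this
    linarith
  rcases le_or_gt (α (twoBlock (r + 1) 0 1)) (1 / m) with hcase | hcase
  · obtain ⟨t, ht, hte⟩ := intermediate_value_Icc hu.1
      (continuousOn_apply_axisPoint hm hcont j₀
        (continuous_twoBlock (r := r + 1) continuous_id (continuous_const (y := (1 : ℝ))))
        fun t ht => hI ⟨ht.1, ht.2.trans hu.2⟩ h1) ⟨hcase, hge⟩
    exact hstep ⟨ht.1, ht.2.trans hu.2⟩ h1 hte
  · have hflip : 1 / (m : ℝ) ≤ α (twoBlock (r + 1) 1 0) := by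
      have hrev : α (fun i => twoBlock (r + 1) 0 1 (Fin.rev i)) = α (twoBlock (r + 1) 0 1) :=
        congrFun (hanon (fun i => axisPoint j₀ (twoBlock (r + 1) 0 1 i))
          (fun i => axisPoint_mem_simplex hm j₀ (hI h0 h1 i).1 (hI h0 h1 i).2) Fin.revPerm) j₀
      have := hrep (τ := fun i => twoBlock (r + 1) 0 1 (Fin.rev i))
        (τ' := twoBlock (r + 1) 1 0) (fun i => hI h0 h1 _) h1 fun i => by
          have := i.2
          unfold twoBlock
          rw [Fin.val_rev]
          split_ifs
          all_goals first | (exfalso; omega) | simp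
      rw [hrev, abs_of_nonneg (by linarith [hα1 _ (hI h1 h0)]),
        abs_of_nonneg (by linarith [hα1 _ (hI h0 h1)])] at this
      linarith
    have hzero : α (twoBlock (r + 1) 0 0) ≤ 1 / m := by
      have := hrep (τ := fun _ => 1 / (m : ℝ)) (τ' := twoBlock (r + 1) 0 0)
        (fun _ => hu) h0 fun i => by simp [twoBlock]
      rw [hαu, zero_sub, zero_sub, abs_neg, abs_neg, abs_of_nonneg (hα0 _ (hI h0 h0)),
        abs_of_nonneg hu.1] at this
      exact this
    have hlow : α (twoBlock (r + 1) (1 / (m : ℝ)) 0) = 1 / m := by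
      obtain ⟨t, ht, hte⟩ := intermediate_value_Icc zero_le_one
        (continuousOn_apply_axisPoint hm hcont j₀
          (continuous_twoBlock (r := r + 1) continuous_id (continuous_const (y := (0 : ℝ))))
          fun t ht => hI ht h0) ⟨hzero, hflip⟩
      exact hstep ht h0 hte
    have hlow' : A (fun i => axisPoint j₀ (twoBlock (r + 1) (1 / (m : ℝ)) 0 i)) =
        axisPoint j₀ (1 / m) := by
      rw [apply_axisPoint_profile hm hmap hneut j₀ (hI hu h0)]
      exact congrArg _ hlow
    by_contra hne
    have hgt : 1 / (m : ℝ) < α (twoBlock (r + 1) (1 / (m : ℝ)) 1) :=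
      lt_of_le_of_ne hge (Ne.symm hne)
    obtain ⟨c, hc1, hc2, hc3⟩ : ∃ c : ℝ, 1 / (m : ℝ) < c ∧ c ≤ 1 / (m - 1) ∧
        c ≤ α (twoBlock (r + 1) (1 / (m : ℝ)) 1) :=
      ⟨min (1 / (m - 1)) (α (twoBlock (r + 1) (1 / (m : ℝ)) 1)),
        lt_min (one_div_lt_one_div_of_lt (by linarith) (by linarith)) hgt,
        min_le_left _ _, min_le_right _ _⟩
    obtain ⟨y, hy, hye⟩ := intermediate_value_Icc hu.2
      (continuousOn_apply_axisPoint hm hcont j₀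
        (continuous_twoBlock (r := r + 1) (continuous_const (y := 1 / (m : ℝ))) continuous_id)
        fun t ht => hI hu ⟨hu.1.trans ht.1, ht.2⟩)
      ⟨hαu'.le.trans hc1.le, hc3⟩
    have hyI : y ∈ Set.Icc (0 : ℝ) 1 := ⟨hu.1.trans hy.1, hy.2⟩
    obtain ⟨j₁, hj₁⟩ : ∃ j₁ : Fin m, j₁ ≠ j₀ :=
      haveI : Nontrivial (Fin m) := Fin.nontrivial_iff_two_le.2 hm
      exists_ne j₀
    have hout : A (fun i => axisPoint j₀ (twoBlock (r + 1) (1 / (m : ℝ)) y i)) =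
        axisPoint j₀ c := by
      rw [apply_axisPoint_profile hm hmap hneut j₀ (hI hu hyI)]
      exact congrArg _ hye
    have hswap : A (fun i => if i ∈ Finset.univ.filter (fun i : Fin (2 * r + 1) => r + 1 ≤ (i : ℕ))
          then axisPoint j₁ 0 else axisPoint j₀ (twoBlock (r + 1) (1 / (m : ℝ)) y i)) =
        fun _ => (1 : ℝ) / m := by
      have h := hneut _ (fun i => axisPoint_mem_simplex hm j₀ (hI hu h0 i).1 (hI hu h0 i).2)
        (Equiv.swap j₀ j₁)
      rw [hlow', axisPoint_inv hm] at h
      rw [← h]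
      congr 1
      funext i
      by_cases hi : (i : ℕ) < r + 1
      · simp only [Finset.mem_filter, Finset.mem_univ, true_and, not_le.2 hi, if_false,
          twoBlock, hi, if_true, axisPoint_inv hm]
      · funext j
        simp only [Finset.mem_filter, Finset.mem_univ, true_and, not_lt.1 hi, if_true,
          twoBlock, hi, if_false, axisPoint, Equiv.swap_apply_eq_iff, Equiv.swap_apply_left]
    have key := htruth.dist1_le_of_replace
      (fun i => axisPoint_mem_simplex hm j₀ (hI hu hyI i).1 (hI hu hyI i).2)
      (axisPoint_mem_simplex hm j₁ h0.1 h0.2)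
      (Finset.univ.filter fun i : Fin (2 * r + 1) => r + 1 ≤ (i : ℕ))
    have hcI : c ∈ Set.Icc (0 : ℝ) 1 :=
      ⟨hu.1.trans hc1.le, hc3.trans (hα1 _ (hI hu h1))⟩
    have hmono : 1 / (m : ℝ) ≤ 1 / (m - 1) :=
      one_div_le_one_div_of_le (by linarith) (by linarith)
    rw [hswap, hout, dist1_axisPoint_zero hm j₁
        (by rw [← axisPoint_inv hm j₀]; exact axisPoint_mem_simplex hm j₀ hu.1 hu.2)
        (fun _ _ => hmono),
      dist1_axisPoint_zero hm j₁ (axisPoint_mem_simplex hm j₀ hcI.1 hcI.2)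
        (fun j _ => by
          unfold axisPoint
          split_ifs
          · exact hc2
          · gcongr
            · linarith
            · linarith [hcI.1]),
      axisPoint, if_neg hj₁] at key
    have : 1 / (m : ℝ) ≤ (1 - c) / (m - 1) := by linarith
    rw [div_le_div_iff₀ (by linarith) (by linarith)] at this
    rw [div_lt_iff₀ (by linarith)] at hc1
    linarith

/-- for odd n, on the profile where ⌈n/2⌉ voters report the uniform
vector and ⌊n/2⌋ voters report e₁, every truthful, anonymous, neutral and continuous
mechanism outputs the uniform vector, which is at ℓ1-distance ((m-1)/m)·((n-1)/n) and
ℓ∞-distance ((m-1)/(2m))·((n-1)/n) from the mean. -/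
theorem stmt1 (m n : ℕ) (hm : 2 ≤ m) (hn : 1 ≤ n) (hnodd : Odd n)
    (A : (Fin n → Fin m → ℝ) → (Fin m → ℝ))
    (hmap : ∀ P : Fin n → Fin m → ℝ, (∀ i, P i ∈ simplex m) → A P ∈ simplex m)
    (htruth : Truthful A)
    (hanon : Anonymous A)
    (hneut : Neutral A)
    (hcont : ContinuousOn A {P : Fin n → Fin m → ℝ | ∀ i, P i ∈ simplex m})
    (u e₁ : Fin m → ℝ)
    (hu : u = fun _ => (1 : ℝ) / m)
    (he₁ : e₁ = fun j : Fin m => if (j : ℕ) = 0 then 1 else 0)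
    (P : Fin n → Fin m → ℝ)
    (hP : P = fun i : Fin n => if (i : ℕ) < (n + 1) / 2 then u else e₁) :
    A P = u ∧
    dist1 (A P) (mean P) = ((m : ℝ) - 1) / m * (((n : ℝ) - 1) / n) ∧
    distInf (A P) (mean P) = ((m : ℝ) - 1) / (2 * m) * (((n : ℝ) - 1) / n) := by
  obtain ⟨r, rfl⟩ := hnodd
  have hm' : (2 : ℝ) ≤ m := by exact_mod_cast hm
  have hhalf : (2 * r + 1 + 1) / 2 = r + 1 := by omega
  rw [hhalf] at hP
  set j₀ : Fin m := ⟨0, by omega⟩ with hj₀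
  have he : e₁ = axisPoint j₀ 1 := by
    rw [he₁]
    funext j
    simp [axisPoint, hj₀, Fin.ext_iff]
  have hAP : A P = u := by
    have h := apply_majority_uniform hm hmap htruth hanon hneut hcont j₀
    rw [axisPoint_inv hm, ← hu] at h
    rw [← h, hP]
    congr 1
    funext i
    unfold twoBlock
    split_ifs
    · rw [axisPoint_inv hm, hu]
    · exact he
  have hdiff : ∀ j, |u j - mean P j| =
      if j = j₀ then (r * (m - 1) / (m * (2 * r + 1)) : ℝ) else r / (m * (2 * r + 1)) := by
    intro j
    have hsum : ∑ i, P i j = (r + 1) * u j + r * e₁ j := by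
      have h := sum_ite_val_lt (u j) (e₁ j) (r + 1) r
      rw [show r + 1 + r = 2 * r + 1 by ring] at h
      push_cast at h
      rw [← h, hP]
      exact Finset.sum_congr rfl fun i _ => by dsimp only; split_ifs <;> rfl
    have hr : (0 : ℝ) ≤ r := Nat.cast_nonneg r
    have hpos : (0 : ℝ) < m * (2 * r + 1) := by positivity
    rw [mean, hsum, he, hu]
    push_cast
    unfold axisPoint
    split_ifs with hj
    · rw [abs_sub_comm, ← abs_of_nonneg
        (div_nonneg (mul_nonneg hr (by linarith : (0 : ℝ) ≤ m - 1)) hpos.le)]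
      congr 1
      field_simp
      ring
    · rw [← abs_of_nonneg (div_nonneg hr hpos.le)]
      congr 1
      field_simp
      ring
  have hm0 : (m : ℝ) ≠ 0 := by linarith
  refine ⟨hAP, ?_, ?_⟩
  · rw [hAP, dist1]
    simp only [hdiff]
    rw [sum_ite_eq_add]
    push_cast
    field_simp
    ring
  · have hval : ((m : ℝ) - 1) / (2 * m) * ((((2 * r + 1 : ℕ) : ℝ) - 1) / (2 * r + 1 : ℕ)) =
        |u j₀ - mean P j₀| := by
      rw [hdiff, if_pos rfl]
      push_cast
      field_simp
      ring
    rw [hAP, distInf, hval]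
    have : Nonempty (Fin m) := ⟨j₀⟩
    refine le_antisymm (ciSup_le fun j => ?_)
      (le_ciSup (f := fun j => |u j - mean P j|) (Set.finite_range _).bddAbove j₀)
    rw [hdiff, hdiff, if_pos rfl]
    split_ifs
    · exact le_rfl
    · gcongr
      exact le_mul_of_one_le_right (Nat.cast_nonneg r) (by linarith)
end

section
/- Fix n ≥ 1 and m ≥ 2, and let A : (Δ^{m−1})^n → Δ^{m−1} be a mechanism that is truthful, neutral, and continuous. Let α_1, …, α_n ∈ [0,1] and γ ∈ [0,1] satisfy A(p(α_1), …, p(α_n)) = p(γ). Let i ∈ {1,…,n} and α* ∈ [0,1] be such that either γ ∉ [min(α_i, α*), max(α_i, α*)] or γ = α*. Then A(p(α_1), …, p(α_{i−1}), p(α*), p(α_{i+1}), …, p(α_n)) = p(γ). -/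
open scoped Classical BigOperators

/-- The symmetric vote p(α) = (α, (1-α)/(m-1), …, (1-α)/(m-1)). -/
noncomputable def pvec (m : ℕ) (α : ℝ) : Fin m → ℝ :=
  fun j => if (j : ℕ) = 0 then α else (1 - α) / ((m : ℝ) - 1)

theorem pvec_mem_simplex {m : ℕ} (hm : 2 ≤ m) {t : ℝ} (ht : t ∈ Set.Icc (0 : ℝ) 1) :
    pvec m t ∈ simplex m := by
  obtain ⟨k, rfl⟩ := Nat.exists_eq_add_of_le' hm
  have hk : (0 : ℝ) < k + 1 := by positivity
  have hden : ((k + 2 : ℕ) : ℝ) - 1 = k + 1 := by push_cast; ring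
  refine ⟨fun j => ?_, ?_⟩
  · unfold pvec
    split_ifs
    · exact ht.1
    · rw [hden]
      exact div_nonneg (sub_nonneg.2 ht.2) hk.le
  · simp only [pvec, hden, Fin.sum_univ_succ, Fin.val_zero, Fin.val_succ]
    simp
    field_simp
    ring

theorem dist1_pvec {m : ℕ} (hm : 2 ≤ m) (s t : ℝ) :
    dist1 (pvec m s) (pvec m t) = 2 * |s - t| := by
  obtain ⟨k, rfl⟩ := Nat.exists_eq_add_of_le' hm
  have hk : (0 : ℝ) < k + 1 := by positivity
  have hden : ((k + 2 : ℕ) : ℝ) - 1 = k + 1 := by push_cast; ring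
  have h : (1 - s) / ((k : ℝ) + 1) - (1 - t) / (k + 1) = (t - s) / (k + 1) := by ring
  simp only [dist1, pvec, hden, Fin.sum_univ_succ, Fin.val_zero, Fin.val_succ]
  simp [h, abs_div, abs_of_pos hk, abs_sub_comm t s]
  field_simp
  ring

theorem continuous_pvec (m : ℕ) : Continuous (pvec m) := by
  refine continuous_pi fun j => ?_
  unfold pvec
  split_ifs <;> fun_prop

/-- A point of the simplex all of whose coordinates but the first agree is symmetric. -/
theorem eq_pvec_of_mem_simplex {m : ℕ} (hm : 2 ≤ m) {x : Fin m → ℝ} (hx : x ∈ simplex m)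
    (h : ∀ j k : Fin m, (j : ℕ) ≠ 0 → (k : ℕ) ≠ 0 → x j = x k) :
    x = pvec m (x ⟨0, by omega⟩) := by
  obtain ⟨k, rfl⟩ := Nat.exists_eq_add_of_le' hm
  have hk : (0 : ℝ) < k + 1 := by positivity
  have hden : ((k + 2 : ℕ) : ℝ) - 1 = k + 1 := by push_cast; ring
  funext j
  unfold pvec
  split_ifs with hj
  · congr 1
    exact Fin.ext hj
  · have hsum := hx.2
    rw [Fin.sum_univ_succ, Finset.sum_congr rfl fun l _ => h l.succ j (by simp) hj] at hsum
    simp only [Finset.sum_const, Finset.card_univ, Fintype.card_fin, nsmul_eq_mul] at hsum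
    rw [hden, eq_div_iff hk.ne']
    push_cast at hsum
    have h0 : (⟨0, by omega⟩ : Fin (k + 2)) = 0 := rfl
    rw [h0]
    linarith

/-- A neutral mechanism maps symmetric profiles to symmetric outcomes. -/
theorem Neutral.eq_pvec {n m : ℕ} (hm : 2 ≤ m) {A : (Fin n → Fin m → ℝ) → (Fin m → ℝ)}
    (hneut : Neutral A)
    (hmap : ∀ P : Fin n → Fin m → ℝ, (∀ i, P i ∈ simplex m) → A P ∈ simplex m)
    {β : Fin n → ℝ} (hβ : ∀ i, β i ∈ Set.Icc (0 : ℝ) 1) :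
    A (fun i => pvec m (β i)) = pvec m (A (fun i => pvec m (β i)) ⟨0, by omega⟩) := by
  have hP : ∀ i, pvec m (β i) ∈ simplex m := fun i => pvec_mem_simplex hm (hβ i)
  refine eq_pvec_of_mem_simplex hm (hmap _ hP) fun j k hj hk => ?_
  have hswap : (fun i l => pvec m (β i) (Equiv.swap j k l)) = fun i => pvec m (β i) := by
    funext i l
    have hval : ((Equiv.swap j k l : Fin m) : ℕ) = 0 ↔ (l : ℕ) = 0 := by
      rw [Equiv.swap_apply_def]
      split_ifs with h₁ h₂
      · simp [h₁, hj, hk]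
      · simp [h₂, hj, hk]
      · rfl
    simp only [pvec, hval]
  have h := congrFun (hneut _ hP (Equiv.swap j k)) j
  simp only [Equiv.swap_apply_left] at h
  rwa [hswap] at h

/-- A continuous one-dimensional strategyproof rule does not react to a voter whose peak moves
without crossing the outcome, or moves onto it. -/
theorem eq_of_strategyproof {g : ℝ → ℝ} {S : Set ℝ} {a b : ℝ} (hS : Set.uIcc a b ⊆ S)
    (hg : ContinuousOn g S) (htr : ∀ s ∈ S, ∀ t ∈ S, |t - g t| ≤ |t - g s|)
    (h : g a ∉ Set.uIcc a b ∨ g a = b) : g b = g a := by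
  have ha : a ∈ S := hS Set.left_mem_uIcc
  have hb : b ∈ S := hS Set.right_mem_uIcc
  have hba := htr a ha b hb
  rcases h with h | h
  · have hab := htr b hb a ha
    have hne : g a ≠ a := fun hga => h (by rw [hga]; exact Set.left_mem_uIcc)
    have hnot : a ∉ Set.uIcc (g a) (g b) := fun hmem => by
      obtain ⟨c, hc, hca⟩ := intermediate_value_uIcc (hg.mono hS) hmem
      have := htr c (hS hc) a ha
      rw [hca, sub_self, abs_zero] at this
      exact hne (sub_eq_zero.1 (abs_nonpos_iff.1 this)).symm
    simp only [Set.mem_uIcc, not_or, not_and, not_le] at h hnot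
    grind
  · rw [h, sub_self, abs_zero] at hba
    rw [h]
    exact (sub_eq_zero.1 (abs_nonpos_iff.1 hba)).symm

/-- if the aggregate on a segment profile is p(γ) and voter i moves
her vote along the segment without crossing γ (or onto γ), the aggregate is unchanged. -/
theorem stmt3 (n m : ℕ) (hn : 1 ≤ n) (hm : 2 ≤ m)
    (A : (Fin n → Fin m → ℝ) → (Fin m → ℝ))
    (hmap : ∀ P : Fin n → Fin m → ℝ, (∀ i, P i ∈ simplex m) → A P ∈ simplex m)
    (htruth : Truthful A)
    (hneut : Neutral A)
    (hcont : ContinuousOn A {P : Fin n → Fin m → ℝ | ∀ i, P i ∈ simplex m})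
    (α : Fin n → ℝ) (hα : ∀ i, α i ∈ Set.Icc (0 : ℝ) 1)
    (γ : ℝ) (hγ : γ ∈ Set.Icc (0 : ℝ) 1)
    (hagg : A (fun i => pvec m (α i)) = pvec m γ)
    (i : Fin n) (αstar : ℝ) (hαstar : αstar ∈ Set.Icc (0 : ℝ) 1)
    (hcross : γ ∉ Set.uIcc (α i) αstar ∨ γ = αstar) :
    A (Function.update (fun i' => pvec m (α i')) i (pvec m αstar)) = pvec m γ := by
  have hupd : ∀ t, Function.update (fun i' => pvec m (α i')) i (pvec m t) =
      fun i' => pvec m (Function.update α i t i') := fun t => by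
    funext i'
    by_cases hi : i' = i
    · subst hi; simp
    · simp [hi]
  have hβ : ∀ t ∈ Set.Icc (0 : ℝ) 1, ∀ i', Function.update α i t i' ∈ Set.Icc (0 : ℝ) 1 := by
    intro t ht i'
    by_cases hi : i' = i
    · subst hi; simpa using ht
    · simpa [hi] using hα i'
  let g : ℝ → ℝ := fun t => A (fun i' => pvec m (Function.update α i t i')) ⟨0, by omega⟩
  have hA : ∀ t ∈ Set.Icc (0 : ℝ) 1,
      A (fun i' => pvec m (Function.update α i t i')) = pvec m (g t) :=
    fun t ht => hneut.eq_pvec hm hmap (hβ t ht)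
  have hgα : g (α i) = γ := by
    simp only [g, Function.update_eq_self, hagg]
    simp [pvec]
  have hcg : ContinuousOn g (Set.Icc 0 1) := by
    refine (continuous_apply _).comp_continuousOn (hcont.comp (Continuous.continuousOn ?_)
      fun t ht i' => pvec_mem_simplex hm (hβ t ht i'))
    have hu : Continuous fun t => Function.update α i t := continuous_const.update i continuous_id
    exact continuous_pi fun i' => (continuous_pvec m).comp ((continuous_apply i').comp hu)
  have htr : ∀ s ∈ Set.Icc (0 : ℝ) 1, ∀ t ∈ Set.Icc (0 : ℝ) 1, |t - g t| ≤ |t - g s| := by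
    intro s hs t ht
    have h := htruth (fun i' => pvec m (Function.update α i t i'))
      (fun i' => pvec_mem_simplex hm (hβ t ht i')) i _ (pvec_mem_simplex hm hs)
    rw [← hupd t, Function.update_idem, hupd t, hupd s, hA t ht, hA s hs,
      Function.update_self, dist1_pvec hm, dist1_pvec hm] at h
    linarith
  rw [hupd, hA _ hαstar, ← hgα, eq_of_strategyproof (Set.uIcc_subset_Icc (hα i) hαstar) hcg htr
    (by rwa [hgα])]
end

section
/- (Truthfulness of VoteCutGreedyMin for three alternatives.) Let m = 3, n ≥ 1, and let c denote the cutoff function c_{0.8} on Δ². For a profile P = (p_1,…,p_n) in (Δ²)^n, let V(P) denote any GreedyMin aggregate (at a GreedyMin normalization time) of the profile (c(p_1),…,c(p_n)). Then for every profile P, every i ∈ {1,…,n}, and every q ∈ Δ², letting P' be the profile obtained from P by replacing p_i with q, it holds that ‖p_i − V(P)‖₁ ≤ ‖p_i − V(P')‖₁. -/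
open scoped Classical BigOperators

/-- The median of a multiset of odd cardinality: the middle element of its sorted list. -/
noncomputable def msMedian (M : Multiset ℝ) : ℝ :=
  (M.sort (· ≤ ·)).getD (M.card / 2) 0

/-- The 2n+1 element multiset {f_0(t), …, f_n(t), p_{1,j}, …, p_{n,j}}. -/
def phantomMS {n m : ℕ} (f : Fin (n + 1) → ℝ → ℝ) (P : Fin n → Fin m → ℝ)
    (t : ℝ) (j : Fin m) : Multiset ℝ :=
  (Finset.univ.val.map fun k => f k t) + (Finset.univ.val.map fun i => P i j)

/-- The GreedyMin phantom system: f_0(t) = min(2t, 1), f_1 = … = f_n = max(0, 2t-1). -/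
noncomputable def gminPhantom (n : ℕ) : Fin (n + 1) → ℝ → ℝ :=
  fun k t => if k = 0 then min (2 * t) 1 else max 0 (2 * t - 1)

/-- The GreedyMin medians med_j(t). -/
noncomputable def gminMed {n m : ℕ} (P : Fin n → Fin m → ℝ) (t : ℝ) : Fin m → ℝ :=
  fun j => msMedian (phantomMS (gminPhantom n) P t j)

/-- t is a GreedyMin normalization time if t ∈ [0,1] and the medians sum to 1;
the associated GreedyMin aggregate is gminMed P t. -/
noncomputable def IsGminNormTime {n m : ℕ} (P : Fin n → Fin m → ℝ) (t : ℝ) : Prop :=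
  t ∈ Set.Icc (0 : ℝ) 1 ∧ ∑ j, gminMed P t j = 1

/-- The cutoff function c_τ: if some coordinate exceeds τ (on the simplex it is
unique), reduce it to τ and redistribute evenly over the other m-1 coordinates. -/
noncomputable def cutoff (m : ℕ) (τ : ℝ) (a : Fin m → ℝ) : Fin m → ℝ :=
  if h : ∃ k, τ < a k then
    fun j =>
      if j = Classical.choose h then τ
      else a j + (a (Classical.choose h) - τ) / ((m : ℝ) - 1)
  else a

lemma msMedian_le_of_countP {M : Multiset ℝ} {k : ℕ} {x : ℝ} (hM : M.card = 2 * k + 1)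
    (hx : k + 1 ≤ M.countP (· ≤ x)) : msMedian M ≤ x := by
  have hlen : (M.sort (· ≤ ·)).length = 2 * k + 1 := by simp [hM]
  have hsort := M.pairwise_sort (· ≤ ·)
  have hc : M.countP (· ≤ x) = (M.sort (· ≤ ·)).countP (· ≤ x) := by
    conv_lhs => rw [← M.sort_eq (· ≤ ·)]
    exact Multiset.coe_countP _ _
  rw [hc] at hx
  have hk : M.card / 2 = k := by omega
  unfold msMedian
  rw [hk]
  generalize M.sort (· ≤ ·) = L at *
  rw [List.getD_eq_getElem _ _ (by omega)]
  by_contra! hlt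
  have h0 : (L.drop k).countP (· ≤ x) = 0 := by
    rw [List.countP_eq_zero]
    intro a ha
    obtain ⟨l, hl, rfl⟩ := List.mem_iff_getElem.mp ha
    rw [List.getElem_drop]
    have : L[k] ≤ L[k + l]'(by simp at hl; omega) :=
      List.SortedLE.getElem_le_getElem_of_le hsort.sortedLE (by omega)
    simpa using hlt.trans_le this
  rw [← List.take_append_drop k L, List.countP_append, h0] at hx
  have h1 := List.countP_le_length (p := fun a => decide (a ≤ x)) (l := L.take k)
  rw [List.length_take] at h1
  omega

lemma le_msMedian_of_countP {M : Multiset ℝ} {k : ℕ} {x : ℝ} (hM : M.card = 2 * k + 1)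
    (hx : k + 1 ≤ M.countP (x ≤ ·)) : x ≤ msMedian M := by
  have hlen : (M.sort (· ≤ ·)).length = 2 * k + 1 := by simp [hM]
  have hsort := M.pairwise_sort (· ≤ ·)
  have hc : M.countP (x ≤ ·) = (M.sort (· ≤ ·)).countP (x ≤ ·) := by
    conv_lhs => rw [← M.sort_eq (· ≤ ·)]
    exact Multiset.coe_countP _ _
  rw [hc] at hx
  have hk : M.card / 2 = k := by omega
  unfold msMedian
  rw [hk]
  generalize M.sort (· ≤ ·) = L at *
  rw [List.getD_eq_getElem _ _ (by omega)]
  by_contra! hlt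
  have h0 : (L.take (k + 1)).countP (x ≤ ·) = 0 := by
    rw [List.countP_eq_zero]
    intro a ha
    obtain ⟨l, hl, rfl⟩ := List.mem_iff_getElem.mp ha
    rw [List.getElem_take]
    have : L[l]'(by simp at hl; omega) ≤ L[k] :=
      List.SortedLE.getElem_le_getElem_of_le hsort.sortedLE (by simp at hl; omega)
    simpa using this.trans_lt hlt
  rw [← List.take_append_drop (k + 1) L, List.countP_append, h0] at hx
  have h1 := List.countP_le_length (p := fun a => decide (x ≤ a)) (l := L.drop (k + 1))
  rw [List.length_drop] at h1
  omega

lemma phantomMS_gminPhantom {n m : ℕ} (P : Fin n → Fin m → ℝ) (t : ℝ) (j : Fin m) :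
    phantomMS (gminPhantom n) P t j =
      min (2 * t) 1 ::ₘ (Multiset.replicate n (max 0 (2 * t - 1)) +
        Finset.univ.val.map fun i => P i j) := by
  have h : (Finset.univ : Finset (Fin n)).val.map (fun _ => max 0 (2 * t - 1)) =
      Multiset.replicate n (max 0 (2 * t - 1)) := by
    simp only [Multiset.map_const', Finset.card_val, Finset.card_univ, Fintype.card_fin]
  rw [← h]
  simp only [phantomMS, gminPhantom, Fin.univ_succ, Finset.cons_val, Finset.map_val,
    Multiset.map_cons, Multiset.map_map, Multiset.cons_add, if_true]
  simp only [Function.comp_def, Function.Embedding.coeFn_mk, Fin.succ_ne_zero, if_false]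

/-- The GreedyMin median depends on the votes only through their minimum. -/
lemma gminMed_eq {n m : ℕ} {P : Fin n → Fin m → ℝ} {t : ℝ} {j : Fin m} {μ : ℝ}
    (ht : t ∈ Set.Icc (0 : ℝ) 1) (hμ : ∀ i, μ ≤ P i j) (hμ' : ∃ i, P i j = μ)
    (h0 : 0 ≤ μ) (h1 : μ ≤ 1) :
    gminMed P t j = if t ≤ 1 / 2 then min (2 * t) μ else max (2 * t - 1) μ := by
  obtain ⟨i, hi⟩ := hμ'
  obtain ⟨ht0, ht1⟩ := ht
  unfold gminMed
  rw [phantomMS_gminPhantom]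
  set V : Multiset ℝ := Finset.univ.val.map fun i => P i j with hV
  have hVcard : V.card = n := by simp [hV]
  have hcard : (min (2 * t) 1 ::ₘ
      (Multiset.replicate n (max 0 (2 * t - 1)) + V)).card = 2 * n + 1 := by
    simp [hVcard]; omega
  have hpos : ∀ x, μ ≤ x → 1 ≤ V.countP (· ≤ x) := fun x hx =>
    Multiset.countP_pos.mpr ⟨μ, Multiset.mem_map.mpr ⟨i, by simp, hi⟩, hx⟩
  have hall : ∀ x, x ≤ μ → V.countP (x ≤ ·) = n := by
    intro x hx
    rw [← hVcard, Multiset.countP_eq_card]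
    intro a ha
    obtain ⟨l, -, rfl⟩ := Multiset.mem_map.mp ha
    exact hx.trans (hμ l)
  have hrep : ∀ (p : ℝ → Prop) [DecidablePred p] (a : ℝ), p a →
      (Multiset.replicate n a).countP p = n := by
    intro p _ a ha
    conv_rhs => rw [← Multiset.card_replicate n a]
    rw [Multiset.countP_eq_card]
    intro b hb
    rwa [Multiset.eq_of_mem_replicate hb]
  split_ifs with h
  · have e1 : max 0 (2 * t - 1) = 0 := max_eq_left (by linarith)
    have e2 : min (2 * t) 1 = 2 * t := min_eq_left (by linarith)
    rw [e1, e2] at hcard ⊢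
    apply le_antisymm
    · apply msMedian_le_of_countP hcard
      rw [Multiset.countP_cons, Multiset.countP_add,
        hrep (· ≤ min (2 * t) μ) 0 (le_min (by linarith) h0)]
      rcases le_total (2 * t) μ with h2 | h2
      · rw [if_pos (le_min le_rfl h2)]; omega
      · have := hpos (min (2 * t) μ) (le_min h2 le_rfl); omega
    · apply le_msMedian_of_countP hcard
      rw [Multiset.countP_cons, Multiset.countP_add, hall _ (min_le_right _ _),
        if_pos (min_le_left _ _)]
      omega
  · have e1 : max 0 (2 * t - 1) = 2 * t - 1 := max_eq_right (by linarith)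
    have e2 : min (2 * t) 1 = 1 := min_eq_right (by linarith)
    rw [e1, e2] at hcard ⊢
    apply le_antisymm
    · apply msMedian_le_of_countP hcard
      rw [Multiset.countP_cons, Multiset.countP_add,
        hrep (· ≤ max (2 * t - 1) μ) _ (le_max_left _ _)]
      have := hpos (max (2 * t - 1) μ) (le_max_right _ _)
      omega
    · apply le_msMedian_of_countP hcard
      rw [Multiset.countP_cons, Multiset.countP_add,
        if_pos (max_le (by linarith) h1 : max (2 * t - 1) μ ≤ 1)]
      rcases le_total (2 * t - 1) μ with h2 | h2
      · rw [hall _ (max_le h2 le_rfl)]; omega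
      · rw [hrep (max (2 * t - 1) μ ≤ ·) _ (max_le le_rfl h2)]; omega

/-- At a normalization time, GreedyMin raises the coordinatewise minima to a common level. -/
lemma exists_gminMed_eq_max {n m : ℕ} {P : Fin n → Fin m → ℝ} {t : ℝ} {μ : Fin m → ℝ}
    (hP : ∀ i, P i ∈ simplex m) (ht : IsGminNormTime P t) (hμ : ∀ i j, μ j ≤ P i j)
    (hμ' : ∀ j, ∃ i, P i j = μ j) :
    ∃ s : ℝ, ∀ j, gminMed P t j = max s (μ j) := by
  have hμ0 : ∀ j, 0 ≤ μ j := fun j => by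
    obtain ⟨i, hi⟩ := hμ' j
    rw [← hi]
    exact (hP i).1 j
  have hμ1 : ∀ j, μ j ≤ 1 := fun j => by
    obtain ⟨i, hi⟩ := hμ' j
    rw [← hi, ← (hP i).2]
    exact Finset.single_le_sum (fun k _ => (hP i).1 k) (Finset.mem_univ j)
  have hmed := fun j => gminMed_eq ht.1 (fun i => hμ i j) (hμ' j) (hμ0 j) (hμ1 j)
  by_cases h : t ≤ 1 / 2
  · simp only [h, if_true] at hmed
    refine ⟨0, fun j => ?_⟩
    rw [max_eq_right (hμ0 j)]
    have hle : ∀ k ∈ Finset.univ, gminMed P t k ≤ μ k := fun k _ => by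
      rw [hmed]; exact min_le_right _ _
    obtain ⟨i, -⟩ := hμ' j
    have hsum : ∑ k, μ k ≤ ∑ k, gminMed P t k := by
      rw [ht.2, ← (hP i).2]
      exact Finset.sum_le_sum fun k _ => hμ i k
    exact (Finset.sum_eq_sum_iff_of_le hle).mp
      (le_antisymm (Finset.sum_le_sum hle) hsum) j (Finset.mem_univ j)
  · simp only [h, if_false] at hmed
    exact ⟨_, hmed⟩

lemma cutoff_cases {a : Fin 3 → ℝ} :
    (cutoff 3 (8 / 10) a = a ∧ ∀ j, a j ≤ 8 / 10) ∨
      ∃ k, 8 / 10 < a k ∧ cutoff 3 (8 / 10) a k = 8 / 10 ∧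
        ∀ j, j ≠ k → cutoff 3 (8 / 10) a j = a j + (a k - 8 / 10) / 2 := by
  by_cases h : ∃ k, 8 / 10 < a k
  · refine Or.inr ⟨Classical.choose h, Classical.choose_spec h, ?_, fun j hj => ?_⟩
    · simp [cutoff, h]
    · rw [cutoff, dif_pos h, if_neg hj]
      norm_num
  · refine Or.inl ⟨by rw [cutoff, dif_neg h], ?_⟩
    push Not at h
    exact h

lemma cutoff_mem_simplex {a : Fin 3 → ℝ} (ha : a ∈ simplex 3) :
    cutoff 3 (8 / 10) a ∈ simplex 3 ∧ ∀ j, cutoff 3 (8 / 10) a j ≤ 8 / 10 := by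
  obtain ⟨h, h'⟩ | ⟨k, hk, hck, hc⟩ := cutoff_cases (a := a)
  · rw [h]
    exact ⟨ha, h'⟩
  · obtain ⟨h0, h1⟩ := ha
    have a0 := h0 0
    have a1 := h0 1
    have a2 := h0 2
    simp only [simplex, Set.mem_ofPred_eq, Fin.sum_univ_three, Fin.forall_fin_succ] at *
    fin_cases k <;> simp at hck hc hk <;> simp [hck, hc] <;>
      and_intros <;> linarith

/-- Truthfulness for a voter whose vote is unaffected by the cutoff. -/
lemma dist1_le_of_eq_max_min {m : ℕ} {p b ν A A' : Fin m → ℝ} {s s' : ℝ}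
    (hA : ∀ j, A j = max s (min (ν j) (p j))) (hA' : ∀ j, A' j = max s' (min (ν j) (b j)))
    (hsum : ∑ j, A j = ∑ j, A' j) : dist1 p A ≤ dist1 p A' := by
  unfold dist1
  rcases le_total s s' with h | h
  · have key : ∑ j, (|p j - A j| + A j) ≤ ∑ j, (|p j - A' j| + A' j) := by
      refine Finset.sum_le_sum fun j _ => ?_
      have h1 : s' ≤ A' j := by rw [hA']; exact le_max_left _ _
      have h2 : A j ≤ max s (p j) := by rw [hA]; exact max_le_max le_rfl (min_le_right _ _)
      have h3 := le_abs_self (p j - A' j)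
      have h4 := neg_abs_le (p j - A' j)
      rcases le_max_iff.mp h2 with h2 | h2 <;>
        rcases abs_cases (p j - A j) with ⟨h5, -⟩ | ⟨h5, -⟩ <;> linarith
    simp only [Finset.sum_add_distrib] at key
    linarith
  · have key : ∑ j, (|p j - A j| - A j) ≤ ∑ j, (|p j - A' j| - A' j) := by
      refine Finset.sum_le_sum fun j _ => ?_
      have h1 : A' j ≤ max s (ν j) := by
        rw [hA']; exact max_le_max h (min_le_left _ _)
      have h2 : s ≤ A j := by rw [hA]; exact le_max_left _ _
      have h3 : min (ν j) (p j) ≤ A j := by rw [hA]; exact le_max_right _ _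
      have h4 := le_abs_self (p j - A' j)
      have h5 := neg_abs_le (p j - A' j)
      rcases le_max_iff.mp h1 with h1 | h1 <;> rcases min_le_iff.mp h3 with h3 | h3 <;>
        rcases abs_cases (p j - A j) with ⟨h6, h7⟩ | ⟨h6, h7⟩ <;> linarith
    simp only [Finset.sum_sub_distrib] at key
    linarith

/-- Truthfulness for a voter whose first coordinate exceeds the cutoff. -/
lemma abs_sum_le_of_cutoff_lt {p₁ p₂ p₃ b₁ b₂ b₃ ν₁ ν₂ ν₃ A₁ A₂ A₃ A₁' A₂' A₃' s s' : ℝ}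
    (hp₁ : 8 / 10 < p₁) (hp₂ : 0 ≤ p₂) (hp₃ : 0 ≤ p₃) (hp : p₁ + p₂ + p₃ = 1)
    (hb₁ : b₁ ≤ 8 / 10)
    (hA₁ : A₁ = max s (min ν₁ (8 / 10)))
    (hA₂ : A₂ = max s (min ν₂ (p₂ + (p₁ - 8 / 10) / 2)))
    (hA₃ : A₃ = max s (min ν₃ (p₃ + (p₁ - 8 / 10) / 2)))
    (hA₁' : A₁' = max s' (min ν₁ b₁)) (hA₂' : A₂' = max s' (min ν₂ b₂))
    (hA₃' : A₃' = max s' (min ν₃ b₃))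
    (hA : A₁ + A₂ + A₃ = 1) (hA' : A₁' + A₂' + A₃' = 1) :
    |p₁ - A₁| + |p₂ - A₂| + |p₃ - A₃| ≤ |p₁ - A₁'| + |p₂ - A₂'| + |p₃ - A₃'| := by
  have s1 : s ≤ A₁ := hA₁ ▸ le_max_left _ _
  have s2 : s ≤ A₂ := hA₂ ▸ le_max_left _ _
  have s3 : s ≤ A₃ := hA₃ ▸ le_max_left _ _
  have s1' : s' ≤ A₁' := hA₁' ▸ le_max_left _ _
  have s2' : s' ≤ A₂' := hA₂' ▸ le_max_left _ _
  have s3' : s' ≤ A₃' := hA₃' ▸ le_max_left _ _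
  have hs : s ≤ 1 / 3 := by linarith
  have hs' : s' ≤ 1 / 3 := by linarith
  have u1 : A₁ ≤ 8 / 10 := hA₁ ▸ max_le (by linarith) (min_le_right _ _)
  have u1' : A₁' ≤ 8 / 10 := hA₁' ▸ max_le (by linarith) ((min_le_right _ _).trans hb₁)
  have u2 : A₂ ≤ 1 / 3 := hA₂ ▸ max_le hs ((min_le_right _ _).trans (by linarith))
  have u3 : A₃ ≤ 1 / 3 := hA₃ ▸ max_le hs ((min_le_right _ _).trans (by linarith))
  have hmono : A₁' ≤ A₁ := by
    rw [hA₁']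
    refine max_le (by linarith) ((min_le_min_left _ hb₁).trans ?_)
    rw [hA₁]
    exact le_max_right _ _
  have a1 := le_abs_self (p₁ - A₁')
  have a2 := le_abs_self (p₂ - A₂')
  have a3 := le_abs_self (p₃ - A₃')
  have b2 := neg_abs_le (p₂ - A₂')
  have b3 := neg_abs_le (p₃ - A₃')
  rw [abs_of_nonneg (by linarith : 0 ≤ p₁ - A₁)]
  rcases le_total p₂ A₂ with h2 | h2 <;> rcases le_total p₃ A₃ with h3 | h3
  · rw [abs_of_nonpos (by linarith), abs_of_nonpos (by linarith)]
    linarith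
  · rw [abs_of_nonpos (by linarith), abs_of_nonneg (by linarith)]
    rcases le_or_gt A₂ A₂' with h | h
    · linarith
    have w : A₂ ≤ max s (p₂ + (p₁ - 8 / 10) / 2) := by
      rw [hA₂]; exact max_le_max le_rfl (min_le_right _ _)
    have v : A₃' ≤ max s' ν₃ := by
      rw [hA₃']; exact max_le_max le_rfl (min_le_left _ _)
    have x : min ν₃ (p₃ + (p₁ - 8 / 10) / 2) ≤ A₃ := by
      rw [hA₃]; exact le_max_right _ _
    rcases le_max_iff.mp v with v | v <;> rcases le_max_iff.mp w with w | w <;>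
      rcases min_le_iff.mp x with x | x <;> linarith
  · rw [abs_of_nonneg (by linarith), abs_of_nonpos (by linarith)]
    rcases le_or_gt A₃ A₃' with h | h
    · linarith
    have w : A₃ ≤ max s (p₃ + (p₁ - 8 / 10) / 2) := by
      rw [hA₃]; exact max_le_max le_rfl (min_le_right _ _)
    have v : A₂' ≤ max s' ν₂ := by
      rw [hA₂']; exact max_le_max le_rfl (min_le_left _ _)
    have x : min ν₂ (p₂ + (p₁ - 8 / 10) / 2) ≤ A₂ := by
      rw [hA₂]; exact le_max_right _ _
    rcases le_max_iff.mp v with v | v <;> rcases le_max_iff.mp w with w | w <;>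
      rcases min_le_iff.mp x with x | x <;> linarith
  · linarith

/-- Truthfulness of raising to a common level the minimum of a cut-off vote and a fixed
vector. -/
lemma dist1_le_of_eq_max_min_cutoff {p b ν A A' : Fin 3 → ℝ} {s s' : ℝ}
    (hp : p ∈ simplex 3) (hb : ∀ j, b j ≤ 8 / 10)
    (hA : ∀ j, A j = max s (min (ν j) (cutoff 3 (8 / 10) p j)))
    (hA' : ∀ j, A' j = max s' (min (ν j) (b j)))
    (hsum : ∑ j, A j = 1) (hsum' : ∑ j, A' j = 1) : dist1 p A ≤ dist1 p A' := by
  obtain ⟨h, -⟩ | ⟨k, hk, hck, hc⟩ := cutoff_cases (a := p)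
  · rw [h] at hA
    exact dist1_le_of_eq_max_min hA hA' (hsum.trans hsum'.symm)
  obtain ⟨h0, h1⟩ := hp
  obtain ⟨i, j, hik, hjk, hij⟩ : ∃ i j : Fin 3, i ≠ k ∧ j ≠ k ∧ i ≠ j := by
    clear * -
    revert k; decide
  have hperm : ∀ f : Fin 3 → ℝ, ∑ l, f l = f k + f i + f j := by
    intro f
    have hu : (Finset.univ : Finset (Fin 3)) = {k, i, j} := by
      clear * - hik hjk hij
      revert k i j; decide
    rw [hu, Finset.sum_insert (by simp [hik.symm, hjk.symm]), Finset.sum_pair hij, add_assoc]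
  unfold dist1
  rw [hperm] at hsum hsum' h1 ⊢
  rw [hperm]
  refine abs_sum_le_of_cutoff_lt (s := s) hk (h0 i) (h0 j) h1 (hb k) ?_ ?_ ?_
    (hA' k) (hA' i) (hA' j) hsum hsum'
  · rw [hA, hck]
  · rw [hA, hc i hik]
  · rw [hA, hc j hjk]

/-- The minimum of the votes other than the `i`-th, capped at `M`. -/
noncomputable def minOthers {n m : ℕ} (M : ℝ) (P : Fin n → Fin m → ℝ) (i : Fin n)
    (j : Fin m) : ℝ :=
  Finset.univ.inf' ⟨i, Finset.mem_univ i⟩ fun k => if k = i then M else P k j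

lemma min_minOthers_le {n m : ℕ} {M : ℝ} {P : Fin n → Fin m → ℝ} {i : Fin n} (k : Fin n)
    (j : Fin m) : min (minOthers M P i j) (P i j) ≤ P k j := by
  by_cases h : k = i
  · exact h ▸ min_le_right _ _
  · refine (min_le_left _ _).trans ?_
    have := Finset.inf'_le (fun k => if k = i then M else P k j) (Finset.mem_univ k)
    simpa only [minOthers, h, if_false] using this

lemma exists_eq_min_minOthers {n m : ℕ} {M : ℝ} {P : Fin n → Fin m → ℝ} {i : Fin n}
    {j : Fin m} (hM : P i j ≤ M) : ∃ k, P k j = min (minOthers M P i j) (P i j) := by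
  obtain ⟨k, -, hk⟩ := Finset.exists_mem_eq_inf' (s := Finset.univ) ⟨i, Finset.mem_univ i⟩
    fun k => if k = i then M else P k j
  change minOthers M P i j = _ at hk
  rcases le_total (P i j) (minOthers M P i j) with h | h
  · exact ⟨i, (min_eq_right h).symm⟩
  · rw [min_eq_left h]
    split_ifs at hk with hki
    · exact ⟨i, le_antisymm (hM.trans_eq hk.symm) h⟩
    · exact ⟨k, hk.symm⟩

/-- VoteCutGreedyMin (apply the cutoff c_{0.8} to every vote, then run
GreedyMin) is truthful for three alternatives. -/
theorem stmt17 (n : ℕ) (hn : 1 ≤ n)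
    (P : Fin n → Fin 3 → ℝ) (hP : ∀ i, P i ∈ simplex 3)
    (i : Fin n) (q : Fin 3 → ℝ) (hq : q ∈ simplex 3)
    (t t' : ℝ)
    (ht : IsGminNormTime (fun i' => cutoff 3 (8 / 10) (P i')) t)
    (ht' : IsGminNormTime (fun i' => cutoff 3 (8 / 10) (Function.update P i q i')) t') :
    dist1 (P i) (gminMed (fun i' => cutoff 3 (8 / 10) (P i')) t) ≤
      dist1 (P i) (gminMed (fun i' => cutoff 3 (8 / 10) (Function.update P i q i')) t') := by
  have key : ∀ (Q : Fin n → Fin 3 → ℝ) (u : ℝ), (∀ k, Q k ∈ simplex 3) →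
      IsGminNormTime (fun k => cutoff 3 (8 / 10) (Q k)) u → ∃ s : ℝ, ∀ j,
        gminMed (fun k => cutoff 3 (8 / 10) (Q k)) u j =
          max s (min (minOthers (8 / 10) (fun k => cutoff 3 (8 / 10) (Q k)) i j)
            (cutoff 3 (8 / 10) (Q i) j)) := fun Q u hQ hu =>
    exists_gminMed_eq_max (fun k => (cutoff_mem_simplex (hQ k)).1) hu
      (fun k j => min_minOthers_le k j)
      fun j => exists_eq_min_minOthers ((cutoff_mem_simplex (hQ i)).2 j)
  have hP' : ∀ k, Function.update P i q k ∈ simplex 3 := by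
    intro k
    by_cases h : k = i
    · simpa [h] using hq
    · simpa [h] using hP k
  obtain ⟨s, hs⟩ := key P t hP ht
  obtain ⟨s', hs'⟩ := key _ t' hP' ht'
  have hothers : minOthers (8 / 10)
      (fun k => cutoff 3 (8 / 10) (Function.update P i q k)) i =
        minOthers (8 / 10) (fun k => cutoff 3 (8 / 10) (P k)) i := by
    funext j
    unfold minOthers
    congr 1
    funext k
    by_cases h : k = i <;> simp [h]
  rw [hothers] at hs'
  exact dist1_le_of_eq_max_min_cutoff (hP i) (cutoff_mem_simplex (hP' i)).2 hs hs' ht.2 ht'.2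
end
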